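/- arXiv:1211.2162 — 2 statements merged into one kernel-verified Lean document; each statement's English description precedes it below -/
import Mathlib

section
/- Let U be an N×N complex matrix and O₁, …, O_N be N×N complex matrices. Suppose s(t), s(t−1) ∈ ℂᴺ satisfy s(t) = U · s(t−1). For each i, suppose either (case I) O_i U = U O_i and define ŝ_i(t) = s(t), ŝ_i(t−1) = s(t−1), or (case II) O_i · conj(U) = U · O_i and define ŝ_i(t) = conj(s(t)), ŝ_i(t−1) = conj(s(t−1)). Let S(t) be the N×N matrix whose i-th column is O_i ŝ_i(t) and S(t−1) the matrix whose i-th column is O_i ŝ_i(t−1). Then S(t) = U · S(t−1). -/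
open Matrix

theorem star_mulVec_eq_map_conj_mulVec {m n : Type*} [Fintype n]
    (A : Matrix m n ℂ) (v : n → ℂ) :
    star (A *ᵥ v) = A.map (starRingEnd ℂ) *ᵥ star v := by
  ext k
  simp [mulVec, dotProduct]

/-- **Eq. (10) of the paper.** Let `U` be an `N×N` complex matrix and `O₁, …, O_N` be `N×N`
complex matrices. Suppose `s(t) = U · s(t−1)`. For each `i`, either (case I)
`O_i U = U O_i` and `ŝ_i(t) = s(t)`, `ŝ_i(t−1) = s(t−1)`, or (case II)
`O_i · conj(U) = U · O_i` and `ŝ_i(t) = conj(s(t))`, `ŝ_i(t−1) = conj(s(t−1))`.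
Let `S(t)` (resp. `S(t−1)`) be the `N×N` matrix whose `i`-th column is `O_i ŝ_i(t)`
(resp. `O_i ŝ_i(t−1)`). Then `S(t) = U · S(t−1)`. -/
theorem stmt_10 (N : ℕ) (U : Matrix (Fin N) (Fin N) ℂ)
    (O : Fin N → Matrix (Fin N) (Fin N) ℂ)
    (st st1 : Fin N → ℂ) (hs : st = U.mulVec st1)
    (shat_t shat_t1 : Fin N → Fin N → ℂ)
    (hcase : ∀ i,
      (O i * U = U * O i ∧ shat_t i = st ∧ shat_t1 i = st1) ∨
      (O i * U.map (starRingEnd ℂ) = U * O i ∧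
        shat_t i = star st ∧ shat_t1 i = star st1)) :
    (Matrix.of fun t i => (O i).mulVec (shat_t i) t) =
      U * Matrix.of fun t i => (O i).mulVec (shat_t1 i) t := by
  have hcol : ∀ i, O i *ᵥ shat_t i = U *ᵥ (O i *ᵥ shat_t1 i) := by
    intro i
    rcases hcase i with ⟨hO, ht, ht1⟩ | ⟨hO, ht, ht1⟩
    · rw [ht, ht1, hs, mulVec_mulVec, mulVec_mulVec, hO]
    · rw [ht, ht1, hs, star_mulVec_eq_map_conj_mulVec, mulVec_mulVec, mulVec_mulVec, hO]
  ext k i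
  exact congrFun (hcol i) k
end

section
/- Let σ > 0 and let N be a positive integer. For every real α, (2α(1−2α)σ²)/(16N) ≤ σ²/(64N), with equality if and only if α = 1/4. Consequently, in the symmetric case σ_f² = σ_g² = σ² with α₁ = α₂ = α, the coding-gain coefficient C_{T₁} = C_{T₂} = 2α(1−2α)σ²/(16N) is maximized uniquely at α = 1/4, i.e., when each source uses power P/4 and the N relays share the remaining half of the total power P. -/
/-- The deficit of the coding-gain coefficient from its maximum is a multiple of a square. -/
theorem codingGain_deficit (σ α : ℝ) {n : ℝ} (hn : n ≠ 0) :
    σ ^ 2 / (64 * n) - (2 * α * (1 - 2 * α) * σ ^ 2) / (16 * n) =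
      σ ^ 2 / (64 * n) * (4 * α - 1) ^ 2 := by
  field_simp
  ring

/-- **Optimum power allocation in the symmetric case (paper, Section V).** For `σ > 0` and a
positive integer `N`, every real `α` satisfies `(2α(1−2α)σ²)/(16N) ≤ σ²/(64N)`, with equality
iff `α = 1/4`. Hence, in the symmetric case `σ_f² = σ_g² = σ²` with `α₁ = α₂ = α`, the
coding-gain coefficient `C_{T₁} = C_{T₂} = 2α(1−2α)σ²/(16N)` is maximized uniquely at
`α = 1/4`, i.e. when each source uses power `P/4` and the `N` relays share the remaining
half of the total power `P`. -/
theorem stmt_17 (σ : ℝ) (hσ : 0 < σ) (N : ℕ) (hN : 0 < N) :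
    ∀ α : ℝ, (2 * α * (1 - 2 * α) * σ ^ 2) / (16 * N) ≤ σ ^ 2 / (64 * N) ∧
      ((2 * α * (1 - 2 * α) * σ ^ 2) / (16 * N) = σ ^ 2 / (64 * N) ↔ α = 1 / 4) := by
  intro α
  have hN' : (0 : ℝ) < N := Nat.cast_pos.mpr hN
  have hc : 0 < σ ^ 2 / (64 * (N : ℝ)) := by positivity
  have hd := codingGain_deficit σ α hN'.ne'
  refine ⟨sub_nonneg.mp (hd ▸ by positivity), ?_⟩
  rw [eq_comm, ← sub_eq_zero, hd, mul_eq_zero, or_iff_right hc.ne', sq_eq_zero_iff]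
  constructor <;> intro h <;> linarith
end
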